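/- Any morphism in fat Delta whose bottom arrow is an identity (a vertical morphism) factors as a composite of vertical faces followed by a composite of bordering extensions: f = v_{k_γ} ∘ ... ∘ v_{k_1} ∘ w^{ε_θ}_{c_θ} ∘ ... ∘ w^{ε_1}_{c_1} with indices in increasing order. -/

import Mathlib

open CategoryTheory SimplexCategory

/-- Fat Delta: objects are epimorphisms in the simplex category. -/
structure FatDelta : Type where
  m : ℕ
  n : ℕ
  hom : SimplexCategory.mk m ⟶ SimplexCategory.mk n
  epi : Epi hom

namespace FatDelta

/-- Morphisms of fat Delta: commutative squares with a monomorphism on top. -/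
structure Hom (A B : FatDelta) : Type where
  top : SimplexCategory.mk A.m ⟶ SimplexCategory.mk B.m
  bot : SimplexCategory.mk A.n ⟶ SimplexCategory.mk B.n
  mono : Mono top
  comm : A.hom ≫ bot = top ≫ B.hom

theorem Hom.ext' {A B : FatDelta} {f g : Hom A B} (h1 : f.top = g.top)
    (h2 : f.bot = g.bot) : f = g := by
  cases f; cases g; simp_all

instance : Category FatDelta where
  Hom := Hom
  id A := ⟨𝟙 _, 𝟙 _, inferInstance, by simp⟩
  comp f g := ⟨f.top ≫ g.top, f.bot ≫ g.bot,
    by haveI := f.mono; haveI := g.mono; exact mono_comp _ _,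
    by rw [← Category.assoc, f.comm, Category.assoc, g.comm, Category.assoc]⟩
  id_comp f := Hom.ext' (by simp) (by simp)
  comp_id f := Hom.ext' (by simp) (by simp)
  assoc f g h := Hom.ext' (by simp) (by simp)

@[simp] theorem comp_top {A B C : FatDelta} (f : A ⟶ B) (g : B ⟶ C) :
    Hom.top (f ≫ g) = Hom.top f ≫ Hom.top g := rfl

@[simp] theorem comp_bot {A B C : FatDelta} (f : A ⟶ B) (g : B ⟶ C) :
    Hom.bot (f ≫ g) = Hom.bot f ≫ Hom.bot g := rfl

@[simp] theorem id_top {A : FatDelta} : Hom.top (𝟙 A) = 𝟙 _ := rfl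
@[simp] theorem id_bot {A : FatDelta} : Hom.bot (𝟙 A) = 𝟙 _ := rfl

end FatDelta

namespace FatDelta

/-- `f` is the degenerated face `d_j`: identity on top and the degeneracy `σ_j` at the
bottom. -/
def IsDegFaceAt {A B : FatDelta} (f : A ⟶ B) (j : ℕ) : Prop :=
  ∃ (hm : A.m = B.m) (hn : A.n = B.n + 1) (hj : j < B.n + 1),
    Hom.top f = eqToHom (congrArg SimplexCategory.mk hm) ∧
    Hom.bot f = eqToHom (congrArg SimplexCategory.mk hn) ≫ SimplexCategory.σ ⟨j, hj⟩

/-- `f` is the standard face `h_i`: the coface `δ_i` at the bottom and the coface `δ_v`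
on top, where `v` is the unique vertex of the target lying over `i` (so `i` is a standard
vertex). -/
def IsStdFaceAt {A B : FatDelta} (f : A ⟶ B) (i : ℕ) : Prop :=
  ∃ (hm : B.m = A.m + 1) (hn : B.n = A.n + 1) (hi : i < A.n + 2) (v : Fin (A.m + 2)),
    Hom.top f = SimplexCategory.δ v ≫ eqToHom (congrArg SimplexCategory.mk hm.symm) ∧
    Hom.bot f = SimplexCategory.δ ⟨i, hi⟩ ≫ eqToHom (congrArg SimplexCategory.mk hn.symm) ∧
    ∀ x : Fin (B.m + 1), B.hom.toOrderHom x = ⟨i, by show i < B.n + 1; omega⟩ ↔ (x : ℕ) = (v : ℕ)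

/-- `f` is the vertical face `v_i`: the coface `δ_i` on top, identity at the bottom, and
the underlying square is a pushout in `Δ`. -/
def IsVertFaceAt {A B : FatDelta} (f : A ⟶ B) (i : ℕ) : Prop :=
  ∃ (hm : B.m = A.m + 1) (hn : B.n = A.n) (hi : i < A.m + 2),
    Hom.top f = SimplexCategory.δ ⟨i, hi⟩ ≫ eqToHom (congrArg SimplexCategory.mk hm.symm) ∧
    Hom.bot f = eqToHom (congrArg SimplexCategory.mk hn.symm) ∧
    IsPushout (SimplexCategory.δ ⟨i, hi⟩) A.hom
      (eqToHom (congrArg SimplexCategory.mk hm.symm) ≫ B.hom ≫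
        eqToHom (congrArg SimplexCategory.mk hn))
      (𝟙 (SimplexCategory.mk A.n))

/-- `f` is the bordering extension `w^ε_c := d_c ∘ h_{c+ε}`, the composite of the
standard face `h_{c+ε}` followed by the degenerated face `d_c`, with `ε ∈ {0,1}`. -/
def IsBordExtAt {A B : FatDelta} (f : A ⟶ B) (c ε : ℕ) : Prop :=
  (ε = 0 ∨ ε = 1) ∧
  ∃ (K : FatDelta) (h : A ⟶ K) (d : K ⟶ B),
    IsStdFaceAt h (c + ε) ∧ IsDegFaceAt d c ∧ f = h ≫ d

end FatDelta

/-- A composite `v_{k_γ} ∘ ⋯ ∘ v_{k_1}` of vertical faces whose indices are in increasing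
order, all indices being at least the given lower bound. -/
inductive VertChain : (A B : FatDelta) → (A ⟶ B) → ℕ → Prop
  | nil (A : FatDelta) (k : ℕ) : VertChain A A (𝟙 A) k
  | cons {A B C : FatDelta} (g : A ⟶ B) (f : B ⟶ C) (i k : ℕ) :
      FatDelta.IsVertFaceAt g i → k ≤ i → VertChain B C f i → VertChain A C (g ≫ f) k

/-- A composite `w^{ε_θ}_{c_θ} ∘ ⋯ ∘ w^{ε_1}_{c_1}` of bordering extensions whose indices
are in increasing order, all indices being at least the given lower bound. -/
inductive BordChain : (A B : FatDelta) → (A ⟶ B) → ℕ → Prop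
  | nil (A : FatDelta) (c : ℕ) : BordChain A A (𝟙 A) c
  | cons {A B C : FatDelta} (g : A ⟶ B) (f : B ⟶ C) (c ε c₀ : ℕ) :
      FatDelta.IsBordExtAt g c ε → c₀ ≤ c → BordChain B C f c → BordChain A C (g ≫ f) c₀

theorem Fin.monotone_insertNth {n : ℕ} {α : Type*} [Preorder α] {f : Fin n → α}
    (hf : Monotone f) (i : Fin (n + 1)) (x : α) (hlt : ∀ j, j.castSucc < i → f j ≤ x)
    (hle : ∀ j, i ≤ j.castSucc → x ≤ f j) :
    Monotone (i.insertNth (α := fun _ => α) x f) := by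
  intro y z hyz
  rcases Fin.eq_self_or_eq_succAbove i y with hy | ⟨j, rfl⟩ <;>
    rcases Fin.eq_self_or_eq_succAbove i z with hz | ⟨k, rfl⟩
  · rw [hy, hz]
  · subst hy
    simp only [Fin.insertNth_apply_same, Fin.insertNth_apply_succAbove]
    exact hle k (Fin.lt_succAbove_iff_le_castSucc _ _ |>.1
      (lt_of_le_of_ne hyz (Fin.succAbove_ne _ _).symm))
  · subst hz
    simp only [Fin.insertNth_apply_same, Fin.insertNth_apply_succAbove]
    exact hlt j (Fin.succAbove_lt_iff_castSucc_lt _ _ |>.1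
      (lt_of_le_of_ne hyz (Fin.succAbove_ne _ _)))
  · simp only [Fin.insertNth_apply_succAbove]
    exact hf ((Fin.strictMono_succAbove i).le_iff_le.1 hyz)

namespace SimplexCategory

/-- A monotone map extends along the coface `δ i`, with a prescribed value `x` at `i`, as soon
as the result is monotone around `i`. -/
theorem exists_δ_comp_eq {a b : ℕ} (f : mk a ⟶ mk b) (i : Fin (a + 2)) (x : Fin (b + 1))
    (hlt : ∀ j : Fin (a + 1), j.castSucc < i → f.toOrderHom j ≤ x)
    (hle : ∀ j : Fin (a + 1), i ≤ j.castSucc → x ≤ f.toOrderHom j) :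
    ∃ g : mk (a + 1) ⟶ mk b, f = δ i ≫ g ∧ g.toOrderHom i = x := by
  refine ⟨Hom.mk ⟨_, Fin.monotone_insertNth f.toOrderHom.monotone i x hlt hle⟩, ?_, ?_⟩
  · ext j : 3
    exact (Fin.insertNth_apply_succAbove (α := fun _ => Fin (b + 1)) i x f.toOrderHom j).symm
  · exact Fin.insertNth_apply_same (α := fun _ => Fin (b + 1)) i x f.toOrderHom

/-- A monomorphism of `Δ` that misses `x` extends to a monomorphism along a coface `δ i`, the
new vertex `i` being sent to `x`. -/
theorem exists_mono_δ_comp_eq {a b : ℕ} (t : mk a ⟶ mk b) [Mono t] (x : Fin (b + 1))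
    (hx : ∀ j, t.toOrderHom j ≠ x) :
    ∃ (i : Fin (a + 2)) (s : mk (a + 1) ⟶ mk b), Mono s ∧ t = δ i ≫ s ∧
      s.toOrderHom i = x := by
  classical
  have hex : ∃ N, ∀ j : Fin (a + 1), N ≤ (j : ℕ) → x < t.toOrderHom j :=
    ⟨a + 1, fun j hj => by omega⟩
  have hN : Nat.find hex < a + 2 :=
    lt_of_le_of_lt (Nat.find_min' hex (m := a + 1) fun j hj => by omega) (by omega)
  obtain ⟨s, hs, hsx⟩ := exists_δ_comp_eq t ⟨Nat.find hex, hN⟩ x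
    (fun j hj => by
      by_contra h
      refine Nat.find_min hex (m := j) hj fun k hk => ?_
      exact lt_of_lt_of_le (not_le.1 h) (t.toOrderHom.monotone hk))
    (fun j hj => (Nat.find_spec hex j hj).le)
  refine ⟨_, s, ?_, hs, hsx⟩
  generalize (⟨Nat.find hex, hN⟩ : Fin (a + 2)) = i at hs hsx
  have ht : Function.Injective t.toOrderHom := mono_iff_injective.1 inferInstance
  have hst (j : Fin (a + 1)) : s.toOrderHom (i.succAbove j) = t.toOrderHom j := by
    rw [hs]; rfl
  refine mono_iff_injective.2 fun y z hyz => ?_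
  rcases Fin.eq_self_or_eq_succAbove i y with hy | ⟨j, rfl⟩ <;>
    rcases Fin.eq_self_or_eq_succAbove i z with hz | ⟨k, rfl⟩
  · rw [hy, hz]
  · subst hy
    exact absurd ((hst k).symm.trans (hyz.symm.trans hsx)) (hx k)
  · subst hz
    exact absurd ((hst j).symm.trans (hyz.trans hsx)) (hx j)
  · rw [ht ((hst j).symm.trans (hyz.trans (hst k)))]

/-- The extension of `δ i ≫ p` by an interior vertex `i` of a fiber of `p` is a pushout. -/
theorem isPushout_δ_of_interior {a n : ℕ} (p : mk (a + 1) ⟶ mk n) (i y z : Fin (a + 2))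
    (hy : y < i) (hz : i < z) (hyz : p.toOrderHom y = p.toOrderHom z) :
    IsPushout (δ i) (δ i ≫ p) p (𝟙 (mk n)) := by
  have key {X : SimplexCategory} (u : mk (a + 1) ⟶ X) (v : mk n ⟶ X)
      (h : δ i ≫ u = (δ i ≫ p) ≫ v) : p ≫ v = u := by
    have hne (w : Fin (a + 2)) (hw : w ≠ i) :
        u.toOrderHom w = v.toOrderHom (p.toOrderHom w) := by
      obtain ⟨j, rfl⟩ := Fin.exists_succAbove_eq hw
      exact DFunLike.congr_fun (congrArg Hom.toOrderHom h) j
    ext w : 3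
    change v.toOrderHom (p.toOrderHom w) = u.toOrderHom w
    by_cases hw : w = i
    · subst hw
      have h₁ := u.toOrderHom.monotone hy.le
      have h₂ := u.toOrderHom.monotone hz.le
      rw [hne y hy.ne] at h₁
      rw [hne z hz.ne', ← hyz] at h₂
      have h₃ := p.toOrderHom.monotone hy.le
      have h₄ := p.toOrderHom.monotone hz.le
      rw [← hyz] at h₄
      rw [← le_antisymm h₃ h₄]
      exact le_antisymm h₁ h₂
    · exact (hne w hw).symm
  refine ⟨⟨by simp⟩, ⟨Limits.PushoutCocone.IsColimit.mk _ (fun s => s.inr) ?_ ?_ ?_⟩⟩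
  · intro s
    exact key s.inl s.inr s.condition
  · intro s
    simp
  · intro s m _ hm
    simpa using hm

end SimplexCategory

namespace FatDelta

/-- The vertical morphism over `mk n` with top arrow `t`. -/
def vertical {a b n : ℕ} {p : SimplexCategory.mk a ⟶ SimplexCategory.mk n}
    {q : SimplexCategory.mk b ⟶ SimplexCategory.mk n} (hp : Epi p) (hq : Epi q)
    (t : SimplexCategory.mk a ⟶ SimplexCategory.mk b) (ht : Mono t) (h : p = t ≫ q) :
    (⟨a, n, p, hp⟩ : FatDelta) ⟶ ⟨b, n, q, hq⟩ :=
  ⟨t, 𝟙 _, ht, by simpa using h⟩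

theorem isVertFaceAt_vertical {a n : ℕ} {p : SimplexCategory.mk (a + 1) ⟶ SimplexCategory.mk n}
    (i y z : Fin (a + 2)) (hp' : Epi (δ i ≫ p)) (hp : Epi p) (hy : y < i) (hz : i < z)
    (hyz : p.toOrderHom y = p.toOrderHom z) :
    IsVertFaceAt (vertical hp' hp (δ i) inferInstance rfl) i := by
  refine ⟨rfl, rfl, i.2, by simp [vertical], by simp [vertical], ?_⟩
  simpa using isPushout_δ_of_interior p i y z hy hz hyz

theorem isBordExtAt_vertical {a n : ℕ} {p : SimplexCategory.mk (a + 1) ⟶ SimplexCategory.mk n}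
    (i : Fin (a + 2)) (hp' : Epi (δ i ≫ p)) (hp : Epi p)
    (h : (∀ j, j < i → p.toOrderHom j < p.toOrderHom i) ∨
      ∀ j, i < j → p.toOrderHom i < p.toOrderHom j) :
    ∃ ε, IsBordExtAt (vertical hp' hp (δ i) inferInstance rfl)
      (p.toOrderHom i : Fin (n + 1)) ε := by
  obtain ⟨c, hc⟩ : ∃ c : Fin (n + 1), p.toOrderHom i = c := ⟨_, rfl⟩
  have hle (j : Fin (a + 2)) (hj : j < i) : p.toOrderHom j ≤ c :=
    hc ▸ p.toOrderHom.monotone hj.le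
  have hge (j : Fin (a + 2)) (hj : i < j) : c ≤ p.toOrderHom j :=
    hc ▸ p.toOrderHom.monotone hj.le
  -- `e` is the standard vertex inserted at the bottom
  obtain ⟨ε, e, hε, he, hσδ, hσe, hlt, hgt⟩ : ∃ (ε : ℕ) (e : Fin (n + 2)), (ε = 0 ∨ ε = 1) ∧
      (e : ℕ) = c + ε ∧ δ e ≫ σ c = 𝟙 _ ∧ c.predAbove e = c ∧
      (∀ j, j < i → e.succAbove (p.toOrderHom j) ≤ e) ∧
      (∀ j, i < j → e ≤ e.succAbove (p.toOrderHom j)) := by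
    rcases h with h | h
    · refine ⟨0, c.castSucc, .inl rfl, rfl, δ_comp_σ_self, by simp, fun j hj => ?_,
        fun j hj => ?_⟩
      · exact ((Fin.succAbove_lt_iff_castSucc_lt _ _).2
          (Fin.castSucc_lt_castSucc_iff.2 (hc ▸ h j hj))).le
      · exact ((Fin.lt_succAbove_iff_le_castSucc _ _).2
          (Fin.castSucc_le_castSucc_iff.2 (hge j hj))).le
    · refine ⟨1, c.succ, .inr rfl, rfl, δ_comp_σ_succ, by simp, fun j hj => ?_,
        fun j hj => ?_⟩
      · exact ((Fin.succAbove_lt_iff_castSucc_lt _ _).2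
          (Fin.castSucc_lt_succ_iff.2 (hle j hj))).le
      · exact ((Fin.lt_succAbove_iff_le_castSucc _ _).2
          (Fin.succ_le_castSucc_iff.2 (hc ▸ h j hj))).le
  obtain ⟨k, hk, hki⟩ := exists_δ_comp_eq ((δ i ≫ p) ≫ δ e) i e
    (fun j hj => hlt _ ((Fin.succAbove_lt_iff_castSucc_lt _ _).2 hj))
    (fun j hj => hgt _ ((Fin.lt_succAbove_iff_le_castSucc _ _).2 hj))
  have hkj (j : Fin (a + 1)) :
      k.toOrderHom (i.succAbove j) = e.succAbove ((δ i ≫ p).toOrderHom j) :=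
    (DFunLike.congr_fun (congrArg SimplexCategory.Hom.toOrderHom hk) j).symm
  have hkσ : k ≫ σ c = p := by
    ext y : 3
    change (σ c).toOrderHom (k.toOrderHom y) = p.toOrderHom y
    rcases Fin.eq_self_or_eq_succAbove i y with rfl | ⟨j, rfl⟩
    · rw [hki, hc]
      exact hσe
    · rw [hkj]
      exact DFunLike.congr_fun (congrArg SimplexCategory.Hom.toOrderHom hσδ) _
  have hkepi : Epi k := epi_iff_surjective.2 fun y => by
    rcases Fin.eq_self_or_eq_succAbove e y with rfl | ⟨v, rfl⟩
    · exact ⟨i, hki⟩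
    · obtain ⟨j, rfl⟩ := epi_iff_surjective.1 hp' v
      exact ⟨_, hkj j⟩
  refine ⟨ε, hε, ⟨a + 1, n + 1, k, hkepi⟩, ⟨δ i, δ e, inferInstance, hk⟩,
    ⟨𝟙 _, σ c, inferInstance, by simpa using hkσ⟩, ?_, ?_, ?_⟩
  · have hce : ((p.toOrderHom i : Fin (n + 1)) : ℕ) + ε = e := by rw [he, hc]
    have hlt : ((p.toOrderHom i : Fin (n + 1)) : ℕ) + ε < n + 2 := hce ▸ e.2
    have hee : (⟨(p.toOrderHom i : Fin (n + 1)) + ε, hlt⟩ : Fin (n + 2)) = e := Fin.ext hce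
    refine ⟨rfl, rfl, hlt, i, by simp, ?_, ?_⟩
    · simp [hee]
    · intro y
      change k.toOrderHom y = ⟨(p.toOrderHom i : Fin (n + 1)) + ε, _⟩ ↔ _
      rw [hee, ← Fin.ext_iff]
      refine ⟨fun hy => ?_, fun hy => hy ▸ hki⟩
      rcases Fin.eq_self_or_eq_succAbove i y with rfl | ⟨j, rfl⟩
      · rfl
      · exact absurd ((hkj j).symm.trans hy) (Fin.succAbove_ne _ _)
  · refine ⟨rfl, rfl, (p.toOrderHom i : Fin (n + 1)).2, by simp, ?_⟩
    simp [hc]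
  · exact Hom.ext' (by simp [vertical]) (by simpa [vertical] using hσδ.symm)

/-- A vertex `x` is interior for the vertical morphism with top arrow `t` if it lies strictly
between two vertices of the image in the same fiber of `q`. -/
def IsInterior {a b n : ℕ} (t : SimplexCategory.mk a ⟶ SimplexCategory.mk b)
    (q : SimplexCategory.mk b ⟶ SimplexCategory.mk n) (x : Fin (b + 1)) : Prop :=
  ∃ y z : Fin (a + 1), t.toOrderHom y < x ∧ x < t.toOrderHom z ∧
    q.toOrderHom (t.toOrderHom y) = q.toOrderHom (t.toOrderHom z)

theorem IsInterior.of_δ_comp {a b n : ℕ} {i : Fin (a + 2)}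
    {s : SimplexCategory.mk (a + 1) ⟶ SimplexCategory.mk b}
    {q : SimplexCategory.mk b ⟶ SimplexCategory.mk n} {x : Fin (b + 1)}
    (h : IsInterior (δ i ≫ s) q x) : IsInterior s q x := by
  obtain ⟨y, z, hy, hz, hyz⟩ := h
  exact ⟨i.succAbove y, i.succAbove z, hy, hz, hyz⟩

/-- A vertical morphism all of whose missing vertices are interior is a composite of vertical
faces. -/
theorem vertChain_vertical {a b n : ℕ} {p : SimplexCategory.mk a ⟶ SimplexCategory.mk n}
    {q : SimplexCategory.mk b ⟶ SimplexCategory.mk n} (hp : Epi p) (hq : Epi q)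
    (t : SimplexCategory.mk a ⟶ SimplexCategory.mk b) (ht : Mono t) (h : p = t ≫ q) (k : ℕ)
    (hint : ∀ x, (∀ j, t.toOrderHom j ≠ x) → IsInterior t q x)
    (hk : ∀ x, (∀ j, t.toOrderHom j ≠ x) → ∀ j : Fin (a + 1), (j : ℕ) < k → t.toOrderHom j < x) :
    VertChain _ _ (vertical hp hq t ht h) k := by
  induction hd : b - a generalizing a k with
  | zero =>
    obtain rfl : a = b := le_antisymm (le_of_mono t) (Nat.sub_eq_zero_iff_le.1 hd)
    obtain rfl := eq_id_of_mono t
    obtain rfl : p = q := by simpa using h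
    exact .nil _ _
  | succ d ih =>
    classical
    obtain ⟨x, hx, hmin⟩ : ∃ x, (∀ j, t.toOrderHom j ≠ x) ∧
        ∀ y, (∀ j, t.toOrderHom j ≠ y) → x ≤ y := by
      have hne : (Finset.univ.filter fun x => ∀ j, t.toOrderHom j ≠ x).Nonempty := by
        by_contra hcon
        have hsurj : Function.Surjective t.toOrderHom := fun x => by
          by_contra hx
          exact hcon ⟨x, by simpa using hx⟩
        have : Epi t := epi_iff_surjective.2 hsurj
        have := le_of_epi t
        omega
      exact ⟨_, (Finset.mem_filter.1 (Finset.min'_mem _ hne)).2,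
        fun y hy => Finset.min'_le _ _ (by simpa using hy)⟩
    obtain ⟨i, s, hs, rfl, rfl⟩ := exists_mono_δ_comp_eq t x hx
    subst h
    have hsq : Epi (s ≫ q) := by
      have : Epi (δ i ≫ s ≫ q) := by simpa using hp
      exact epi_of_epi (δ i) _
    have hsm : StrictMono s.toOrderHom :=
      s.toOrderHom.monotone.strictMono_of_injective (mono_iff_injective.1 hs)
    obtain ⟨y, z, hy, hz, hyz⟩ := hint _ hx
    have hz' : i < i.succAbove z := hsm.lt_iff_lt.1 hz
    have hmiss (x) (hx : ∀ j, s.toOrderHom j ≠ x) (j : Fin (a + 1)) :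
        (δ i ≫ s).toOrderHom j ≠ x := hx (i.succAbove j)
    refine .cons (vertical hp hsq (δ i) inferInstance (by simp)) (vertical hsq hq s hs rfl) i k
      ?_ ?_ ?_
    · exact isVertFaceAt_vertical (p := s ≫ q) i (i.succAbove y) (i.succAbove z) hp hsq
        (hsm.lt_iff_lt.1 hy) hz' hyz
    · by_contra hki
      have hia : (i : ℕ) < a + 1 := lt_of_lt_of_le hz' (Fin.le_last _)
      have h₁ : i.succAbove ⟨i, hia⟩ < i :=
        hsm.lt_iff_lt.1 (hk _ hx ⟨i, hia⟩ (not_le.1 hki))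
      exact lt_irrefl (i : ℕ) ((Fin.succAbove_lt_iff_castSucc_lt _ _).1 h₁)
    · exact ih hsq s hs rfl i (fun x hx => (hint x (hmiss x hx)).of_δ_comp)
        (fun x hx j hj => lt_of_lt_of_le (hsm hj) (hmin x (hmiss x hx))) (by omega)

theorem exists_bordChain_vertChain_vertical {a b n : ℕ}
    {p : SimplexCategory.mk a ⟶ SimplexCategory.mk n}
    {q : SimplexCategory.mk b ⟶ SimplexCategory.mk n} (hp : Epi p) (hq : Epi q)
    (t : SimplexCategory.mk a ⟶ SimplexCategory.mk b) (ht : Mono t) (h : p = t ≫ q) (c : ℕ)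
    (hc : ∀ x, (∀ j, t.toOrderHom j ≠ x) → ¬ IsInterior t q x →
      c ≤ (q.toOrderHom x : Fin (n + 1))) :
    ∃ (M : FatDelta) (φ : _ ⟶ M) (ν : M ⟶ _),
      BordChain _ M φ c ∧ VertChain M _ ν 0 ∧ vertical hp hq t ht h = φ ≫ ν := by
  induction hd : b - a generalizing a c with
  | zero =>
    refine ⟨_, 𝟙 _, _, .nil _ _, vertChain_vertical hp hq t ht h 0 (fun x hx => ?_)
      (fun _ _ _ hj => absurd hj (Nat.not_lt_zero _)), (Category.id_comp _).symm⟩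
    obtain rfl : a = b := le_antisymm (le_of_mono t) (Nat.sub_eq_zero_iff_le.1 hd)
    obtain rfl := eq_id_of_mono t
    exact absurd rfl (hx x)
  | succ d ih =>
    classical
    by_cases hint : ∀ x, (∀ j, t.toOrderHom j ≠ x) → IsInterior t q x
    · exact ⟨_, 𝟙 _, _, .nil _ _, vertChain_vertical hp hq t ht h 0 hint
        (fun _ _ _ hj => absurd hj (Nat.not_lt_zero _)), (Category.id_comp _).symm⟩
    obtain ⟨x, ⟨hx, hxint⟩, hmin⟩ : ∃ x, ((∀ j, t.toOrderHom j ≠ x) ∧ ¬ IsInterior t q x) ∧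
        ∀ y, (∀ j, t.toOrderHom j ≠ y) → ¬ IsInterior t q y → x ≤ y := by
      push Not at hint
      obtain ⟨x, hx⟩ := hint
      have hne : (Finset.univ.filter fun x =>
          (∀ j, t.toOrderHom j ≠ x) ∧ ¬ IsInterior t q x).Nonempty := ⟨x, by simpa using hx⟩
      exact ⟨_, (Finset.mem_filter.1 (Finset.min'_mem _ hne)).2,
        fun y hy hy' => Finset.min'_le _ _ (by simpa using ⟨hy, hy'⟩)⟩
    obtain ⟨i, s, hs, rfl, rfl⟩ := exists_mono_δ_comp_eq t x hx
    subst h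
    have hsq : Epi (s ≫ q) := by
      have : Epi (δ i ≫ s ≫ q) := by simpa using hp
      exact epi_of_epi (δ i) _
    have hsm : StrictMono s.toOrderHom :=
      s.toOrderHom.monotone.strictMono_of_injective (mono_iff_injective.1 hs)
    have hborder : (∀ j, j < i → (s ≫ q).toOrderHom j < (s ≫ q).toOrderHom i) ∨
        ∀ j, i < j → (s ≫ q).toOrderHom i < (s ≫ q).toOrderHom j := by
      by_contra hcon
      push Not at hcon
      obtain ⟨⟨y, hy, hyq⟩, z, hz, hzq⟩ := hcon
      obtain ⟨y, rfl⟩ := Fin.exists_succAbove_eq hy.ne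
      obtain ⟨z, rfl⟩ := Fin.exists_succAbove_eq hz.ne'
      exact hxint ⟨y, z, hsm hy, hsm hz,
        le_antisymm ((s ≫ q).toOrderHom.monotone (hy.trans hz).le) (hzq.trans hyq)⟩
    obtain ⟨ε, hε⟩ := isBordExtAt_vertical (p := s ≫ q) i hp hsq hborder
    obtain ⟨M, φ, ν, hφ, hν, hφν⟩ := ih hsq s hs rfl
      ((s ≫ q).toOrderHom i : Fin (n + 1)) (fun x hx hxs => q.toOrderHom.monotone
        (hmin x (fun j => hx (i.succAbove j)) fun hx' => hxs hx'.of_δ_comp)) (by omega)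
    refine ⟨M, _, ν, .cons _ φ _ ε c hε (hc _ hx hxint) hφ, hν, ?_⟩
    refine Eq.trans ?_ ((congrArg (_ ≫ ·) hφν).trans (Category.assoc _ _ _).symm)
    exact Hom.ext' rfl (Category.id_comp _).symm

end FatDelta

/-- Any morphism of fat Delta whose bottom arrow is an identity (a vertical morphism)
factors as a composite of bordering extensions followed by a composite of vertical
faces, `f = v_{k_γ} ∘ ⋯ ∘ v_{k_1} ∘ w^{ε_θ}_{c_θ} ∘ ⋯ ∘ w^{ε_1}_{c_1}`, with indices in
increasing order. -/
theorem fatDelta_vertical_morphism_factorisation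
    (A B : FatDelta) (f : A ⟶ B) (hn : A.n = B.n)
    (hbot : FatDelta.Hom.bot f = eqToHom (congrArg SimplexCategory.mk hn)) :
    ∃ (M : FatDelta) (φ : A ⟶ M) (ν : M ⟶ B) (c₀ k₀ : ℕ),
      BordChain A M φ c₀ ∧ VertChain M B ν k₀ ∧ f = φ ≫ ν := by
  obtain ⟨a, n, p, hp⟩ := A
  obtain ⟨b, n', q, hq⟩ := B
  obtain rfl : n = n' := hn
  obtain ⟨t, u, ht, hcomm⟩ := f
  obtain rfl : u = 𝟙 _ := hbot
  obtain ⟨M, φ, ν, hφ, hν, h⟩ := FatDelta.exists_bordChain_vertChain_vertical hp hq t ht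
    (by simpa using hcomm) 0 (fun _ _ _ => Nat.zero_le _)
  exact ⟨M, φ, ν, 0, 0, hφ, hν, h⟩
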